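/- (Lemma 2.3, Vitali covering by sections.) Assume λ ≤ det D²u ≤ Λ in Ω. Then there exists a constant δ ∈ (0, 1) depending only on n, λ, Λ such that: for every compact set D ⊂ Ω and every function h : D → (0, ∞) with S_u(x, h(x)) ⊂⊂ Ω for each x ∈ D, there exist finitely many points x₁, …, x_m ∈ D such that D ⊆ ⋃_{i=1}^m S_u(x_i, h(x_i)) and the sections S_u(x_i, δ h(x_i)), i = 1, …, m, are pairwise disjoint. -/

import Mathlib

open MeasureTheory

noncomputable section

/-- Euclidean space `ℝⁿ`. -/
abbrev E (n : ℕ) := EuclideanSpace ℝ (Fin n)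

/-- First partial derivative `∂_i f (x)`. -/
noncomputable def pd {n : ℕ} (f : E n → ℝ) (x : E n) (i : Fin n) : ℝ :=
  fderiv ℝ f x (EuclideanSpace.single i 1)

/-- Second partial derivative `∂_{ij} f (x)`. -/
noncomputable def pd2 {n : ℕ} (f : E n → ℝ) (x : E n) (i j : Fin n) : ℝ :=
  fderiv ℝ (fun y => fderiv ℝ f y (EuclideanSpace.single j 1)) x (EuclideanSpace.single i 1)

/-- Hessian matrix `D²f(x)`. -/
noncomputable def Hess {n : ℕ} (f : E n → ℝ) (x : E n) : Matrix (Fin n) (Fin n) ℝ :=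
  Matrix.of fun i j => pd2 f x i j

/-- The cofactor matrix `U = (det D²u)(D²u)⁻¹` of the Hessian of `u`,
realized as the adjugate. -/
noncomputable def cofU {n : ℕ} (u : E n → ℝ) (x : E n) : Matrix (Fin n) (Fin n) ℝ :=
  (Hess u x).adjugate

/-- Section of the convex function `u`:
`S_u(x₀,t) = {x ∈ cl Ω : u x < u x₀ + ∇u(x₀)·(x - x₀) + t}`. -/
def MASection {n : ℕ} (Ω : Set (E n)) (u : E n → ℝ) (x₀ : E n) (t : ℝ) : Set (E n) :=
  {x ∈ closure Ω | u x < u x₀ + fderiv ℝ u x₀ (x - x₀) + t}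

/-- `A ⊂⊂ B`: the closure of `A` is a compact subset of `B`. -/
def CptIn {n : ℕ} (A B : Set (E n)) : Prop :=
  IsCompact (closure A) ∧ closure A ⊆ B

/-- Uniform convexity of a domain: balls of radius proportional to `‖x - y‖²`
centered at midpoints of points of the closure stay in the closure. -/
def UnifConvex {n : ℕ} (Ω : Set (E n)) : Prop :=
  ∃ δ > 0, ∀ x ∈ closure Ω, ∀ y ∈ closure Ω,
    Metric.closedBall (midpoint ℝ x y) (δ * ‖x - y‖ ^ 2) ⊆ closure Ω

/-- Standing assumptions: `Ω` is a bounded, open, nonempty, uniformly convex domain and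
`u` is a smooth convex function on `cl Ω` vanishing on `∂Ω`. -/
def MASetup {n : ℕ} (Ω : Set (E n)) (u : E n → ℝ) : Prop :=
  IsOpen Ω ∧ Bornology.IsBounded Ω ∧ Ω.Nonempty ∧ UnifConvex Ω ∧
  ContDiffOn ℝ (⊤ : ℕ∞) u (closure Ω) ∧ ConvexOn ℝ (closure Ω) u ∧
  ∀ x ∈ frontier Ω, u x = 0

/-- `λ ≤ det D²u ≤ Λ` in `Ω`. -/
def DetBounds {n : ℕ} (Ω : Set (E n)) (u : E n → ℝ) (lam Lam : ℝ) : Prop :=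
  ∀ x ∈ Ω, lam ≤ (Hess u x).det ∧ (Hess u x).det ≤ Lam

/-- The Monge-Ampère measure of `u`: `μ(A) = ∫_A det D²u`. -/
noncomputable def maMeasure {n : ℕ} (u : E n → ℝ) (A : Set (E n)) : ℝ :=
  ∫ x in A, (Hess u x).det

/-- Center of mass of a set. -/
noncomputable def centerOfMass {n : ℕ} (S : Set (E n)) : E n :=
  (volume S).toReal⁻¹ • ∫ x in S, x

/-- The `α`-dilation of `S` with respect to its center of mass. -/
def dilateCM {n : ℕ} (α : ℝ) (S : Set (E n)) : Set (E n) :=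
  (fun x => centerOfMass S + α • (x - centerOfMass S)) '' S

/-- The Monge-Ampère measure of `u` is doubling with respect to the center of mass
on the sections of `u`, with constants `0 < α < 1 < β`. -/
def DoublingCM {n : ℕ} (Ω : Set (E n)) (u : E n → ℝ) (α β : ℝ) : Prop :=
  0 < α ∧ α < 1 ∧ 1 < β ∧
  ∀ x₀ ∈ Ω, ∀ t : ℝ, 0 < t → CptIn (MASection Ω u x₀ t) Ω →
    maMeasure u (MASection Ω u x₀ t) ≤ β * maMeasure u (dilateCM α (MASection Ω u x₀ (t / 2)))

/-- `g` is a Green's function of the linearized Monge-Ampère operator `L_u` in `V`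
with pole `y`: positive and smooth on `V \ {y}`, `L_u`-harmonic there, vanishing
continuously on `∂V`, and `∫_V g · (L_u φ) = φ(y)` (i.e. `∫_V g · U^{ij}∂_{ij}φ = -φ(y)`)
for all test functions `φ`. -/
def IsGreen {n : ℕ} (u : E n → ℝ) (V : Set (E n)) (y : E n) (g : E n → ℝ) : Prop :=
  (∀ x ∈ V \ {y}, 0 < g x) ∧
  ContDiffOn ℝ (⊤ : ℕ∞) g (V \ {y}) ∧
  (∀ x ∈ V \ {y}, ∑ i, ∑ j, cofU u x i j * pd2 g x i j = 0) ∧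
  ContinuousOn g (closure V \ {y}) ∧
  (∀ x ∈ frontier V, g x = 0) ∧
  ∀ φ : E n → ℝ, ContDiff ℝ (⊤ : ℕ∞) φ → HasCompactSupport φ → tsupport φ ⊆ V →
    (∫ x in V, g x * ∑ i, ∑ j, cofU u x i j * pd2 φ x i j) = -φ y

/-- Capacity of a compact set `K` relative to `V` for the operator `L_u`:
the infimum of `∫_V U^{ij} ∂_iΦ ∂_jΦ` over Lipschitz `Φ` compactly supported in `V`
with `Φ ≥ 1` on `K`. -/
noncomputable def capacity {n : ℕ} (u : E n → ℝ) (K V : Set (E n)) : ℝ :=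
  sInf { e : ℝ | ∃ Φ : E n → ℝ, (∃ L : NNReal, LipschitzWith L Φ) ∧
    HasCompactSupport Φ ∧ tsupport Φ ⊆ V ∧ (∀ x ∈ K, 1 ≤ Φ x) ∧
    e = ∫ x in V, ∑ i, ∑ j, cofU u x i j * pd Φ x i * pd Φ x j }


open Set Filter Topology Matrix

/-! ### Calculus preliminaries -/

/-- A convex function lies above its tangent planes. -/
theorem ConvexOn.add_fderiv_le {F : Type*} [NormedAddCommGroup F] [NormedSpace ℝ F]
    {s : Set F} {u : F → ℝ} (hu : ConvexOn ℝ s u) {z y : F} (hz : z ∈ s) (hy : y ∈ s)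
    (hd : DifferentiableAt ℝ u z) : u z + fderiv ℝ u z (y - z) ≤ u y := by
  have hline : ConvexOn ℝ (AffineMap.lineMap (k := ℝ) z y ⁻¹' s)
      (u ∘ AffineMap.lineMap (k := ℝ) z y) := hu.comp_affineMap _
  have hderiv : HasDerivAt (u ∘ AffineMap.lineMap (k := ℝ) z y) (fderiv ℝ u z (y - z)) 0 := by
    have h1 : HasFDerivAt u (fderiv ℝ u z) (AffineMap.lineMap (k := ℝ) z y 0) := by
      simpa using hd.hasFDerivAt
    exact h1.comp_hasDerivAt (0 : ℝ) AffineMap.hasDerivAt_lineMap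
  have h := hline.le_slope_of_hasDerivAt (x := 0) (y := 1) (by simpa using hz)
    (by simpa using hy) one_pos hderiv
  simp [slope_def_field] at h
  rw [map_sub]
  linarith

/-- If a function of one variable lies locally above a quadratic polynomial touching it at `0`,
then its second derivative there is at least that of the polynomial. -/
theorem le_second_deriv_of_eventually_le {φ φ' : ℝ → ℝ} {b c k : ℝ}
    (h1 : ∀ᶠ t in 𝓝 0, HasDerivAt φ (φ' t) t) (h2 : HasDerivAt φ' k 0)
    (h : ∀ᶠ t in 𝓝 0, φ 0 + b * t + c / 2 * t ^ 2 ≤ φ t) : c ≤ k := by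
  by_contra! hlt
  set χ : ℝ → ℝ := fun t => φ 0 + b * t + c / 2 * t ^ 2 - φ t with hχ
  have hχ0 : χ 0 = 0 := by simp [hχ]
  have hmax : IsLocalMax χ 0 := by
    filter_upwards [h] with t ht
    rw [hχ0]; simp only [hχ]; linarith
  have hd1 : ∀ᶠ t in 𝓝 0, HasDerivAt χ (b + c * t - φ' t) t := by
    filter_upwards [h1] with t ht
    have : HasDerivAt (fun t : ℝ => φ 0 + b * t + c / 2 * t ^ 2) (b + c * t) t := by
      have := (((hasDerivAt_id t).const_mul b).const_add (φ 0)).add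
        (((hasDerivAt_id t).pow 2).const_mul (c / 2))
      refine this.congr_deriv ?_
      simp; ring
    exact this.sub ht
  have hdd : deriv χ =ᶠ[𝓝 0] fun t => b + c * t - φ' t := by
    filter_upwards [hd1] with t ht using ht.deriv
  have hd2 : deriv (deriv χ) 0 = c - k := by
    rw [hdd.deriv_eq]
    have : HasDerivAt (fun t : ℝ => b + c * t - φ' t) (c - k) 0 := by
      have := (((hasDerivAt_id (0 : ℝ)).const_mul c).const_add b).sub h2
      refine this.congr_deriv ?_
      simp
    exact this.deriv
  have hmin : IsLocalMin χ 0 :=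
    isLocalMin_of_deriv_deriv_pos (by rw [hd2]; linarith) hmax.deriv_eq_zero
      hd1.self_of_nhds.continuousAt
  have hconst : χ =ᶠ[𝓝 0] fun _ => χ 0 := by
    filter_upwards [hmax, hmin] with t h3 h4 using le_antisymm h3 h4
  have : deriv (deriv χ) 0 = 0 := by
    have h5 : deriv χ =ᶠ[𝓝 0] fun _ => 0 := by
      have := hconst.deriv
      simpa using this
    rw [h5.deriv_eq]; simp
  linarith

/-! ### Determinants of symmetric matrices -/

theorem Matrix.PosSemidef.det_le_pow {n : ℕ} {A : Matrix (Fin n) (Fin n) ℝ}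
    (hA : A.PosSemidef) {β : ℝ} (hβ : ∀ i, A i i ≤ β) : A.det ≤ β ^ n := by
  rcases Nat.eq_zero_or_pos n with rfl | hn
  · simp
  have hn' : (0 : ℝ) < n := by exact_mod_cast hn
  have hnn : ∀ i, 0 ≤ hA.isHermitian.eigenvalues i := hA.eigenvalues_nonneg
  have htr : ∑ i, hA.isHermitian.eigenvalues i ≤ n * β := by
    have h1 := hA.isHermitian.trace_eq_sum_eigenvalues
    have h2 : A.trace ≤ ∑ _i : Fin n, β := Finset.sum_le_sum fun i _ => hβ i
    simp at h1 h2
    linarith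
  have hgm := Real.geom_mean_le_arith_mean_weighted Finset.univ (fun _ : Fin n => (n : ℝ)⁻¹)
    hA.isHermitian.eigenvalues (fun _ _ => by positivity)
    (by simp [hn'.ne']) (fun i _ => hnn i)
  rw [← Finset.mul_sum] at hgm
  have hle : ∏ i, hA.isHermitian.eigenvalues i ^ (n : ℝ)⁻¹ ≤ β := by
    refine hgm.trans ?_
    rw [inv_mul_le_iff₀ hn']
    exact htr
  have hdet : A.det = (∏ i, hA.isHermitian.eigenvalues i ^ (n : ℝ)⁻¹) ^ n := by
    rw [hA.isHermitian.det_eq_prod_eigenvalues, ← Finset.prod_pow]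
    refine Finset.prod_congr rfl fun i _ => ?_
    rw [Real.rpow_inv_natCast_pow (hnn i) hn.ne']
    simp
  rw [hdet]
  exact pow_le_pow_left₀ (Finset.prod_nonneg fun i _ => Real.rpow_nonneg (hnn i) _) hle n

theorem Matrix.IsHermitian.pow_mul_trace_le {n : ℕ} {A : Matrix (Fin n) (Fin n) ℝ}
    (hA : A.IsHermitian) {a : ℝ} (ha : 0 < a)
    (h : ∀ v : Fin n → ℝ, a * (v ⬝ᵥ v) ≤ v ⬝ᵥ (A *ᵥ v)) :
    a ^ (n - 1) * A.trace ≤ n * A.det := by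
  have hev : ∀ i, a ≤ hA.eigenvalues i := by
    intro i
    have h1 := h (hA.eigenvectorBasis i)
    rw [hA.mulVec_eigenvectorBasis, dotProduct_smul] at h1
    have h2 : (hA.eigenvectorBasis i : Fin n → ℝ) ⬝ᵥ (hA.eigenvectorBasis i : Fin n → ℝ) = 1 := by
      have := hA.eigenvectorBasis.orthonormal.1 i
      rw [EuclideanSpace.norm_eq, Real.sqrt_eq_one] at this
      simpa [dotProduct, pow_two] using this
    rw [h2] at h1
    simpa using h1
  have hdet : A.det = ∏ i, hA.eigenvalues i := by simpa using hA.det_eq_prod_eigenvalues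
  have htr : A.trace = ∑ i, hA.eigenvalues i := by simpa using hA.trace_eq_sum_eigenvalues
  rw [htr, hdet, Finset.mul_sum]
  have key : ∀ i ∈ Finset.univ,
      a ^ (n - 1) * hA.eigenvalues i ≤ ∏ j, hA.eigenvalues j := by
    intro i hi
    rw [← Finset.prod_erase_mul _ _ hi]
    refine mul_le_mul_of_nonneg_right ?_ (ha.le.trans (hev i))
    have := Finset.prod_le_prod (s := Finset.univ.erase i) (f := fun _ => a)
      (g := hA.eigenvalues) (fun _ _ => ha.le) (fun j _ => hev j)
    simpa [Finset.card_erase_of_mem] using this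
  simpa using Finset.sum_le_sum key

/-! ### The Hessian as a quadratic form -/

section Hessian

variable {n : ℕ} {u : E n → ℝ} {x : E n}

theorem hess_apply (hu : ContDiffAt ℝ 2 u x) (i j : Fin n) :
    Hess u x i j = fderiv ℝ (fderiv ℝ u) x (EuclideanSpace.single i 1)
      (EuclideanSpace.single j 1) := by
  have hd : DifferentiableAt ℝ (fderiv ℝ u) x :=
    (hu.fderiv_right (m := 1) (by norm_num)).differentiableAt (by norm_num)
  have h := (hd.hasFDerivAt.clm_apply
    (hasFDerivAt_const (EuclideanSpace.single j (1 : ℝ)) x)).fderiv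
  simp only [Hess, pd2, Matrix.of_apply]
  rw [h]
  simp

theorem hess_isHermitian (hu : ContDiffAt ℝ 2 u x) : (Hess u x).IsHermitian := by
  ext i j
  have hs : IsSymmSndFDerivAt ℝ u x := hu.isSymmSndFDerivAt (by simp)
  simp only [Matrix.conjTranspose_apply, star_trivial, hess_apply hu]
  exact hs _ _

theorem toLp_eq_sum_single (v : Fin n → ℝ) :
    WithLp.toLp 2 v = ∑ i, v i • EuclideanSpace.single i (1 : ℝ) := by
  ext j
  simp [Finset.sum_apply, Pi.single_apply]

theorem dotProduct_hess_mulVec (hu : ContDiffAt ℝ 2 u x) (v : Fin n → ℝ) :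
    v ⬝ᵥ (Hess u x *ᵥ v) =
      fderiv ℝ (fderiv ℝ u) x (WithLp.toLp 2 v) (WithLp.toLp 2 v) := by
  rw [toLp_eq_sum_single]
  simp only [dotProduct, Matrix.mulVec, hess_apply hu, map_sum, map_smul,
    FunLike.coe_sum, Finset.sum_apply, FunLike.coe_smul, Pi.smul_apply, smul_eq_mul,
    Finset.mul_sum]
  rw [Finset.sum_comm]
  refine Finset.sum_congr rfl fun j _ => Finset.sum_congr rfl fun i _ => ?_
  ring

theorem eventually_hasDerivAt_line (hu : ContDiffAt ℝ 2 u x) (ξ : E n) :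
    ∀ᶠ t : ℝ in 𝓝 0, HasDerivAt (fun t : ℝ => u (x + t • ξ)) (fderiv ℝ u (x + t • ξ) ξ) t := by
  have hev : ∀ᶠ y in 𝓝 x, DifferentiableAt ℝ u y := by
    filter_upwards [hu.eventually (by simp)] with y hy using hy.differentiableAt (by norm_num)
  have hcont : Tendsto (fun t : ℝ => x + t • ξ) (𝓝 0) (𝓝 x) := by
    have : Continuous fun t : ℝ => x + t • ξ := by fun_prop
    simpa using this.tendsto 0
  filter_upwards [hcont.eventually hev] with t ht
  have hl : HasDerivAt (fun t : ℝ => x + t • ξ) ξ t := by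
    simpa using ((hasDerivAt_id t).smul_const ξ).const_add x
  exact ht.hasFDerivAt.comp_hasDerivAt t hl

theorem hasDerivAt_fderiv_line (hu : ContDiffAt ℝ 2 u x) (v : Fin n → ℝ) :
    HasDerivAt (fun t : ℝ => fderiv ℝ u (x + t • WithLp.toLp 2 v) (WithLp.toLp 2 v))
      (v ⬝ᵥ (Hess u x *ᵥ v)) 0 := by
  have hd : DifferentiableAt ℝ (fderiv ℝ u) x :=
    (hu.fderiv_right (m := 1) (by norm_num)).differentiableAt (by norm_num)
  have hl : HasDerivAt (fun t : ℝ => x + t • WithLp.toLp 2 v) (WithLp.toLp 2 v) 0 := by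
    simpa using ((hasDerivAt_id (0 : ℝ)).smul_const (WithLp.toLp 2 v)).const_add x
  have h1 : HasFDerivAt (fderiv ℝ u) (fderiv ℝ (fderiv ℝ u) x)
      (x + (0 : ℝ) • WithLp.toLp 2 v) := by simpa using hd.hasFDerivAt
  have h2 : HasDerivAt (fun t : ℝ => fderiv ℝ u (x + t • WithLp.toLp 2 v))
      (fderiv ℝ (fderiv ℝ u) x (WithLp.toLp 2 v)) 0 := h1.comp_hasDerivAt (0 : ℝ) hl
  rw [dotProduct_hess_mulVec hu]
  exact (ContinuousLinearMap.apply ℝ ℝ (WithLp.toLp 2 v)).hasFDerivAt.comp_hasDerivAt (0 : ℝ) h2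

theorem le_dotProduct_hess_mulVec (hu : ContDiffAt ℝ 2 u x) {v : Fin n → ℝ} {b c : ℝ}
    (h : ∀ᶠ t : ℝ in 𝓝 0, u x + b * t + c / 2 * t ^ 2 ≤ u (x + t • WithLp.toLp 2 v)) :
    c ≤ v ⬝ᵥ (Hess u x *ᵥ v) :=
  le_second_deriv_of_eventually_le (eventually_hasDerivAt_line hu _)
    (hasDerivAt_fderiv_line hu v) (by simpa using h)

theorem dotProduct_hess_mulVec_le (hu : ContDiffAt ℝ 2 u x) {v : Fin n → ℝ} {b c : ℝ}
    (h : ∀ᶠ t : ℝ in 𝓝 0, u (x + t • WithLp.toLp 2 v) ≤ u x + b * t + c / 2 * t ^ 2) :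
    v ⬝ᵥ (Hess u x *ᵥ v) ≤ c := by
  have := le_second_deriv_of_eventually_le (b := -b) (c := -c)
    ((eventually_hasDerivAt_line hu (WithLp.toLp 2 v)).mono fun t ht => ht.neg)
    (hasDerivAt_fderiv_line hu v).neg (by
      filter_upwards [h] with t ht
      simp only [Pi.neg_apply, zero_smul, add_zero]
      linarith)
  linarith

theorem ConvexOn.posSemidef_hess {s : Set (E n)} (hs : ConvexOn ℝ s u) (hx : s ∈ 𝓝 x)
    (hu : ContDiffAt ℝ 2 u x) : (Hess u x).PosSemidef := by
  refine Matrix.PosSemidef.of_dotProduct_mulVec_nonneg (hess_isHermitian hu) fun v => ?_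
  have hcont : Tendsto (fun t : ℝ => x + t • WithLp.toLp 2 v) (𝓝 0) (𝓝 x) := by
    have : Continuous fun t : ℝ => x + t • WithLp.toLp 2 v := by fun_prop
    simpa using this.tendsto 0
  simp only [star_trivial]
  refine le_dotProduct_hess_mulVec hu (b := fderiv ℝ u x (WithLp.toLp 2 v)) ?_
  filter_upwards [hcont.eventually hx] with t ht
  have := hs.add_fderiv_le (mem_of_mem_nhds hx) ht (hu.differentiableAt (by norm_num))
  simp at this ⊢
  linarith

end Hessian

/-! ### Affine normalization by a simplex of maximal volume -/

/-- A bounded set with nonempty interior sits between a simplex with vertex `z` and the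
parallelepiped, centered at `z`, spanned by the edges of that simplex at `z`. The edges are the
columns of `T`. -/
theorem exists_frame {n : ℕ} {C : Set (E n)} (hC : IsCompact C) {z : E n} (hz : C ∈ 𝓝 z) :
    ∃ T : Matrix (Fin n) (Fin n) ℝ, T.det ≠ 0 ∧ (∀ i, z + WithLp.toLp 2 (Tᵀ i) ∈ C) ∧
      ∀ x ∈ C, ∀ i, |(T⁻¹ *ᵥ WithLp.ofLp (x - z)) i| ≤ 1 := by
  set edge : (Fin n → E n) → Matrix (Fin n) (Fin n) ℝ :=
    fun p => Matrix.of fun j i => (p i - z) j with hedge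
  have hcont : Continuous fun p : Fin n → E n => |(edge p).det| := by
    refine Continuous.abs (Continuous.matrix_det ?_)
    refine continuous_matrix fun i j => ?_
    simp only [hedge, Matrix.of_apply]
    fun_prop
  obtain ⟨p, hpC, hmax⟩ := (isCompact_univ_pi fun _ : Fin n => hC).exists_isMaxOn
    ⟨fun _ => z, fun _ _ => mem_of_mem_nhds hz⟩ hcont.continuousOn
  have hdet : (edge p).det ≠ 0 := by
    obtain ⟨r, hr, hrC⟩ := Metric.mem_nhds_iff.1 hz
    have h1 := hmax (show (fun i => z + (r / 2) • EuclideanSpace.single i (1 : ℝ)) ∈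
        Set.pi univ fun _ : Fin n => C by
      intro i _
      refine hrC ?_
      simp [norm_smul, abs_of_pos hr, hr])
    have h2 : edge (fun i => z + (r / 2) • EuclideanSpace.single i (1 : ℝ)) =
        (r / 2) • (1 : Matrix (Fin n) (Fin n) ℝ) := by
      ext j i
      simp [hedge, Matrix.one_apply]
    simp only [mem_ofPred_eq, h2, Matrix.det_smul, Matrix.det_one, mul_one, abs_pow] at h1
    have h3 : 0 < |r / 2| ^ Fintype.card (Fin n) := by positivity
    exact abs_pos.1 (h3.trans_le h1)
  refine ⟨edge p, hdet, fun i => ?_, fun x hx i => ?_⟩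
  · have : z + WithLp.toLp 2 ((edge p)ᵀ i) = p i := by
      ext j
      simp [hedge]
    rw [this]
    exact hpC i (mem_univ i)
  · have h1 := hmax (show Function.update p i x ∈ Set.pi univ fun _ : Fin n => C by
      intro k _
      rcases eq_or_ne k i with rfl | hk
      · simpa using hx
      · simpa [hk] using hpC k (mem_univ k))
    have h2 : edge (Function.update p i x) = (edge p).updateCol i (WithLp.ofLp (x - z)) := by
      ext j k
      rcases eq_or_ne k i with rfl | hk
      · simp [hedge]
      · simp [hedge, hk]
    have h3 : ((edge p)⁻¹ *ᵥ WithLp.ofLp (x - z)) i =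
        (edge p).det⁻¹ * ((edge p).updateCol i (WithLp.ofLp (x - z))).det := by
      rw [Matrix.inv_def, Matrix.smul_mulVec, ← Matrix.cramer_eq_adjugate_mulVec,
        Pi.smul_apply, Matrix.cramer_apply, Ring.inverse_eq_inv', smul_eq_mul]
    rw [h3, abs_mul, abs_inv, inv_mul_le_iff₀ (abs_pos.2 hdet), mul_one, ← h2]
    exact h1

/-! ### Quadratic barriers on sublevel sets -/

/-- The closed sublevel set `C` of a convex function `u` with Hessian determinant pinched between
`lam` and `Lam`, cut out by the affine function `p + c`. -/
structure PinchedSublevel {n : ℕ} (u : E n → ℝ) (lam Lam : ℝ) (p : E n →L[ℝ] ℝ) (c : ℝ)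
    (C : Set (E n)) : Prop where
  isCompact : IsCompact C
  convex : Convex ℝ C
  contDiffAt : ∀ x ∈ C, ContDiffAt ℝ 2 u x
  posSemidef : ∀ x ∈ C, (Hess u x).PosSemidef
  le_det : ∀ x ∈ C, lam ≤ (Hess u x).det
  det_le : ∀ x ∈ C, (Hess u x).det ≤ Lam
  le_affine : ∀ x ∈ C, u x ≤ p x + c
  mem_nhds : ∀ x ∈ C, u x < p x + c → C ∈ 𝓝 x

namespace PinchedSublevel

variable {n : ℕ} {u : E n → ℝ} {lam Lam c : ℝ} {p : E n →L[ℝ] ℝ} {C : Set (E n)}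

theorem continuousOn (h : PinchedSublevel u lam Lam p c C) : ContinuousOn u C :=
  fun x hx => (h.contDiffAt x hx).continuousAt.continuousWithinAt

theorem dotProduct_conj (T H : Matrix (Fin n) (Fin n) ℝ) (v : Fin n → ℝ) :
    v ⬝ᵥ ((Tᵀ * H * T) *ᵥ v) = (T *ᵥ v) ⬝ᵥ (H *ᵥ (T *ᵥ v)) := by
  rw [← Matrix.mulVec_mulVec, ← Matrix.mulVec_mulVec, Matrix.dotProduct_mulVec,
    Matrix.vecMul_transpose]

theorem conj_apply_self (T H : Matrix (Fin n) (Fin n) ℝ) (i : Fin n) :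
    (Tᵀ * H * T) i i = (Tᵀ i) ⬝ᵥ (H *ᵥ (Tᵀ i)) := by
  have h := dotProduct_conj T H (Pi.single i 1)
  rw [single_one_dotProduct, Matrix.mulVec_single_one, Matrix.mulVec_single_one] at h
  exact h

/-- The depth of a sublevel set controls its size from above. -/
theorem mul_det_sq_le (hn : 0 < n) (h : PinchedSublevel u lam Lam p c C) {M : ℝ} (hM : 0 < M)
    (hdepth : ∀ x ∈ C, p x + c - u x ≤ M) {z : E n} (hz : z ∈ C)
    {T : Matrix (Fin n) (Fin n) ℝ} (hT : ∀ i, z + WithLp.toLp 2 (Tᵀ i) ∈ C) :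
    lam * T.det ^ 2 ≤ (9 * n ^ 2 * M) ^ n := by
  have hn' : (0 : ℝ) < n := by exact_mod_cast hn
  set r : ℝ := 1 / (2 * n) with hr
  have hr0 : 0 < r := by positivity
  set X : (Fin n → ℝ) → E n := fun y => z + WithLp.toLp 2 (T *ᵥ y) with hX
  have hXc : Continuous X := by
    have : Continuous fun y : Fin n → ℝ => T *ᵥ y := by fun_prop
    fun_prop
  set Q : Set (Fin n → ℝ) := Set.pi univ fun _ => Icc 0 (2 * r) with hQ
  have hXC : ∀ y ∈ Q, X y ∈ C := by
    intro y hy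
    have hy0 : ∀ i, 0 ≤ y i := fun i => (hy i (mem_univ i)).1
    have hys : ∑ i, y i ≤ 1 := by
      calc ∑ i, y i ≤ ∑ _i : Fin n, 2 * r := Finset.sum_le_sum fun i _ => (hy i (mem_univ i)).2
        _ = 1 := by simp [hr]; field_simp
    have hcomb := h.convex.sum_mem (t := Finset.univ)
      (w := fun o : Option (Fin n) => o.elim (1 - ∑ i, y i) y)
      (z := fun o : Option (Fin n) => o.elim z fun i => z + WithLp.toLp 2 (Tᵀ i))
      (by rintro (_ | i) _
          · simpa using hys
          · exact hy0 i)
      (by simp [Fintype.sum_option])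
      (by rintro (_ | i) _
          · exact hz
          · exact hT i)
    convert hcomb using 1
    ext j
    simp [hX, Fintype.sum_option, Finset.sum_add_distrib, Matrix.mulVec, dotProduct,
      ← Finset.sum_mul, mul_comm (T j _)]
    ring
  set β : ℝ := 9 * n ^ 2 * M with hβ
  set F : (Fin n → ℝ) → ℝ := fun y => u (X y) - p (X y) - c - β / 2 * ∑ i, (y i - r) ^ 2 with hF
  have hFc : ContinuousOn F Q := by
    have h1 : ContinuousOn (fun y => u (X y)) Q := h.continuousOn.comp hXc.continuousOn hXC
    refine ((h1.sub (by fun_prop)).sub continuousOn_const).sub ?_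
    fun_prop
  have hQc : IsCompact Q := isCompact_univ_pi fun _ => isCompact_Icc
  have hcen : (fun _ => r : Fin n → ℝ) ∈ Q := fun i _ => ⟨hr0.le, by linarith⟩
  obtain ⟨y, hyQ, hmax⟩ := hQc.exists_isMaxOn ⟨_, hcen⟩ hFc
  have hFy : -M ≤ F y := by
    have h1 := hmax hcen
    have h2 := hdepth _ (hXC _ hcen)
    simp only [hF, mem_ofPred_eq, sub_self] at h1
    simp only [hF]
    norm_num at h1
    linarith
  have hopen : ∀ i, |y i - r| < r := by
    intro i
    by_contra! hge
    have h1 := h.le_affine _ (hXC y hyQ)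
    have h2 : r ^ 2 ≤ ∑ i, (y i - r) ^ 2 := by
      calc r ^ 2 ≤ (y i - r) ^ 2 := by
            rw [← sq_abs (y i - r)]; exact pow_le_pow_left₀ hr0.le hge 2
        _ ≤ _ := Finset.single_le_sum (f := fun i => (y i - r) ^ 2)
            (fun _ _ => sq_nonneg _) (Finset.mem_univ i)
    have h3 : β / 2 * r ^ 2 = 9 / 8 * M := by
      simp only [hβ, hr]; field_simp; ring
    have h4 : β / 2 * r ^ 2 ≤ β / 2 * ∑ i, (y i - r) ^ 2 :=
      mul_le_mul_of_nonneg_left h2 (by positivity)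
    simp only [hF] at hFy
    linarith
  set H := Hess u (X y)
  have hdiag : ∀ i, (Tᵀ * H * T) i i ≤ β := by
    intro i
    rw [conj_apply_self]
    refine dotProduct_hess_mulVec_le (b := p (WithLp.toLp 2 (Tᵀ i)) + β * (y i - r))
      (h.contDiffAt _ (hXC y hyQ)) ?_
    have hev : ∀ᶠ t : ℝ in 𝓝 0, |y i + t - r| < r := by
      have : Continuous fun t : ℝ => |y i + t - r| := by fun_prop
      exact this.continuousAt.eventually_lt_const (by simpa using hopen i)
    filter_upwards [hev] with t ht
    have hmem : y + Pi.single i t ∈ Q := by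
      intro k hk
      rcases eq_or_ne k i with rfl | hki
      · have := abs_lt.1 ht
        simp only [Pi.add_apply, Pi.single_eq_same, mem_Icc]
        constructor <;> linarith
      · simpa [hki] using hyQ k hk
    have hXt : X (y + Pi.single i t) = X y + t • WithLp.toLp 2 (Tᵀ i) := by
      ext j
      simp [hX, Matrix.mulVec_add, Matrix.mulVec_single, add_assoc]
    have hsum : ∑ k, ((y + Pi.single i t : Fin n → ℝ) k - r) ^ 2 =
        ∑ k, (y k - r) ^ 2 + (2 * t * (y i - r) + t ^ 2) := by
      rw [← Finset.add_sum_erase _ _ (Finset.mem_univ i),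
        ← Finset.add_sum_erase _ (fun k => (y k - r) ^ 2) (Finset.mem_univ i)]
      have : ∑ k ∈ Finset.univ.erase i, ((y + Pi.single i t : Fin n → ℝ) k - r) ^ 2 =
          ∑ k ∈ Finset.univ.erase i, (y k - r) ^ 2 := by
        refine Finset.sum_congr rfl fun k hk => ?_
        simp [Finset.ne_of_mem_erase hk]
      rw [this]
      simp
      ring
    have hle := hmax hmem
    simp only [hF, mem_ofPred_eq] at hle
    rw [hXt, hsum, map_add, map_smul, smul_eq_mul] at hle
    linarith
  have hpsd : (Tᵀ * H * T).PosSemidef := by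
    have := (h.posSemidef _ (hXC y hyQ)).conjTranspose_mul_mul_same T
    simpa using this
  have hfin := hpsd.det_le_pow hdiag
  rw [Matrix.det_mul, Matrix.det_mul, Matrix.det_transpose] at hfin
  have := h.le_det _ (hXC y hyQ)
  calc lam * T.det ^ 2 ≤ H.det * T.det ^ 2 := by gcongr
    _ = T.det * H.det * T.det := by ring
    _ ≤ _ := hfin

/-- If `u` is deep inside the sublevel set at a point `z` where a nonnegative affine function
`q + e` is relatively small, then a quadratic barrier bounds the size of the set from below. -/
theorem le_mul_det_sq (hn : 0 < n) (h : PinchedSublevel u lam Lam p c C)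
    {M : ℝ} (hM : 0 < M) {q : E n →L[ℝ] ℝ} {e : ℝ} (hq : ∀ x ∈ C, 0 ≤ q x + e)
    {z w : E n} (hz : z ∈ C) (hw : w ∈ C) (hqw : 0 < q w + e) {ρ N : ℝ} (hρ : ρ ≤ 1 / 2)
    (hN : 0 ≤ N) (hNρ : N * ρ ≤ 1 / 16) (hqz : q z + e ≤ ρ * (q w + e))
    (hdeep : M / 2 < p z + c - u z)
    {T : Matrix (Fin n) (Fin n) ℝ} (hT0 : T.det ≠ 0)
    (hT : ∀ x ∈ C, ∀ i, |(T⁻¹ *ᵥ WithLp.ofLp (x - z)) i| ≤ 1) :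
    (M / (4 * n)) ^ (n - 1) * (M * N / (2 * n)) ≤ n * (Lam * T.det ^ 2) := by
  have hn' : (0 : ℝ) < n := by exact_mod_cast hn
  have hTu : IsUnit T.det := isUnit_iff_ne_zero.2 hT0
  have hqc : Continuous fun x => q x + e := by fun_prop
  obtain ⟨x₁, hx₁, hmax⟩ := h.isCompact.exists_isMaxOn ⟨w, hw⟩ hqc.continuousOn
  set m : ℝ := q x₁ + e with hm
  have hwm : q w + e ≤ m := hmax hw
  have hm0 : 0 < m := hqw.trans_le hwm
  have hρ0 : 0 ≤ ρ := by
    by_contra! hneg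
    have := hq z hz
    nlinarith
  have hzm : q z + e ≤ ρ * m := hqz.trans (mul_le_mul_of_nonneg_left hwm hρ0)
  set Y : E n → Fin n → ℝ := fun x => T⁻¹ *ᵥ WithLp.ofLp (x - z) with hY
  set g : E n → ℝ := fun x => (q x + e) / m with hg
  have hg0 : ∀ x ∈ C, 0 ≤ g x := fun x hx => div_nonneg (hq x hx) hm0.le
  have hg1 : ∀ x ∈ C, g x ≤ 1 := fun x hx => (div_le_one hm0).2 (hmax hx)
  set P : E n → ℝ := fun x =>
    M * (1 / (8 * n) * (Y x ⬝ᵥ Y x - n) + N * (g x ^ 2 - 2 * g x)) with hP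
  have hP0 : ∀ x ∈ C, P x ≤ 0 := by
    intro x hx
    have h1 : Y x ⬝ᵥ Y x ≤ n := by
      calc Y x ⬝ᵥ Y x ≤ ∑ _i : Fin n, (1 : ℝ) := Finset.sum_le_sum fun i _ => by
            have := abs_le.1 (hT x hx i)
            simp only [hY]
            nlinarith
        _ = n := by simp
    have h2 : g x ^ 2 - 2 * g x ≤ 0 := by nlinarith [hg0 x hx, hg1 x hx]
    have h3 : 1 / (8 * n) * (Y x ⬝ᵥ Y x - n) ≤ 0 :=
      mul_nonpos_of_nonneg_of_nonpos (by positivity) (by linarith)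
    have h4 : N * (g x ^ 2 - 2 * g x) ≤ 0 := mul_nonpos_of_nonneg_of_nonpos hN h2
    exact mul_nonpos_of_nonneg_of_nonpos hM.le (by linarith)
  have hPz : -(M / 4) ≤ P z := by
    have h1 : Y z = 0 := by simp [hY]
    have h2 : g z ≤ ρ := (div_le_iff₀ hm0).2 hzm
    have h3 : N * g z ≤ 1 / 16 := (mul_le_mul_of_nonneg_left h2 hN).trans hNρ
    have h4 : 1 / (8 * (n : ℝ)) * (0 - n) = -(1 / 8) := by field_simp; ring
    have h5 : 0 ≤ N * g z ^ 2 := by positivity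
    simp only [hP, h1, dotProduct_zero, h4]
    nlinarith
  have hYc : Continuous Y := by
    have h1 : Continuous fun x : E n => WithLp.ofLp (x - z) := by fun_prop
    exact continuous_const.matrix_mulVec h1
  have hPc : Continuous P := by
    have h1 : Continuous fun x => Y x ⬝ᵥ Y x := hYc.dotProduct hYc
    have h2 : Continuous g := hqc.div_const m
    fun_prop
  set F : E n → ℝ := fun x => u x - p x - c - P x with hF
  have hFc : ContinuousOn F C :=
    ((h.continuousOn.sub p.continuous.continuousOn).sub continuousOn_const).sub hPc.continuousOn
  obtain ⟨x, hxC, hmin⟩ := h.isCompact.exists_isMinOn ⟨z, hz⟩ hFc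
  have hFx : F x < 0 := by
    have h1 : F x ≤ F z := hmin hz
    have h2 : F z < 0 := by simp only [hF]; linarith
    exact h1.trans_lt h2
  have hxnhds : C ∈ 𝓝 x := by
    refine h.mem_nhds x hxC ?_
    have := hP0 x hxC
    simp only [hF] at hFx
    linarith
  set H := Hess u x with hH
  set α : Fin n → ℝ := fun i => q (WithLp.toLp 2 (Tᵀ i)) / m with hα
  have hqT : ∀ v : Fin n → ℝ, q (WithLp.toLp 2 (T *ᵥ v)) / m = α ⬝ᵥ v := by
    intro v
    have h1 : WithLp.toLp 2 (T *ᵥ v) = ∑ i, v i • WithLp.toLp 2 (Tᵀ i) := by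
      ext j
      simp [Matrix.mulVec, dotProduct, mul_comm]
    rw [h1, map_sum]
    simp only [map_smul, smul_eq_mul, dotProduct, hα, Finset.sum_div]
    exact Finset.sum_congr rfl fun i _ => by ring
  have hform : ∀ v : Fin n → ℝ,
      2 * M * (1 / (8 * n) * (v ⬝ᵥ v) + N * (α ⬝ᵥ v) ^ 2) ≤ v ⬝ᵥ ((Tᵀ * H * T) *ᵥ v) := by
    intro v
    rw [dotProduct_conj]
    set ξ : E n := WithLp.toLp 2 (T *ᵥ v) with hξ
    refine le_dotProduct_hess_mulVec
      (b := p ξ + M * (1 / (8 * n) * (2 * (Y x ⬝ᵥ v)) + N * ((2 * g x - 2) * (α ⬝ᵥ v))))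
      (h.contDiffAt x hxC) ?_
    have hcont : Tendsto (fun t : ℝ => x + t • ξ) (𝓝 0) (𝓝 x) := by
      have : Continuous fun t : ℝ => x + t • ξ := by fun_prop
      simpa using this.tendsto 0
    filter_upwards [hcont.eventually hxnhds] with t ht
    have h1 : F x ≤ F (x + t • ξ) := hmin ht
    have h2 : Y (x + t • ξ) = Y x + t • v := by
      have h3 : WithLp.ofLp (x + t • ξ - z) = WithLp.ofLp (x - z) + t • (T *ᵥ v) := by
        ext j
        simp [hξ]
        ring
      simp only [hY]
      rw [h3, Matrix.mulVec_add, Matrix.mulVec_smul, Matrix.mulVec_mulVec,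
        Matrix.nonsing_inv_mul T hTu, Matrix.one_mulVec]
    have h4 : g (x + t • ξ) = g x + t * (α ⬝ᵥ v) := by
      rw [← hqT v]
      simp only [hg, map_add, map_smul, smul_eq_mul]
      ring
    have h5 : (Y x + t • v) ⬝ᵥ (Y x + t • v) =
        Y x ⬝ᵥ Y x + 2 * t * (Y x ⬝ᵥ v) + t ^ 2 * (v ⬝ᵥ v) := by
      rw [add_dotProduct, dotProduct_add, dotProduct_add, smul_dotProduct, smul_dotProduct,
        dotProduct_smul, dotProduct_smul, dotProduct_comm v (Y x)]
      simp only [smul_eq_mul]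
      ring
    simp only [hF, hP] at h1
    rw [h2, h4, h5, map_add, map_smul, smul_eq_mul] at h1
    linarith
  have hα2 : 1 / (4 * n) ≤ ∑ i, α i ^ 2 := by
    set y := Y x₁ with hy
    have h1 : 1 / 2 ≤ α ⬝ᵥ y := by
      rw [← hqT, hy]
      simp only [hY]
      rw [Matrix.mulVec_mulVec, Matrix.mul_nonsing_inv T hTu, Matrix.one_mulVec,
        WithLp.toLp_ofLp, le_div_iff₀ hm0, map_sub]
      have : ρ * m ≤ 1 / 2 * m := mul_le_mul_of_nonneg_right hρ hm0.le
      linarith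
    have h2 : (α ⬝ᵥ y) ^ 2 ≤ (∑ i, α i ^ 2) * ∑ i, y i ^ 2 :=
      Finset.sum_mul_sq_le_sq_mul_sq _ _ _
    have h3 : ∑ i, y i ^ 2 ≤ n := by
      calc ∑ i, y i ^ 2 ≤ ∑ _i : Fin n, (1 : ℝ) := Finset.sum_le_sum fun i _ => by
            have := abs_le.1 (hT x₁ hx₁ i)
            simp only [hy, hY]
            nlinarith
        _ = n := by simp
    have h4 : 0 ≤ ∑ i, α i ^ 2 := Finset.sum_nonneg fun _ _ => sq_nonneg _
    rw [div_le_iff₀ (by positivity)]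
    nlinarith
  have hherm : (Tᵀ * H * T).IsHermitian := by
    have := ((h.posSemidef x hxC).conjTranspose_mul_mul_same T).isHermitian
    simpa using this
  have hdet := hherm.pow_mul_trace_le (a := M / (4 * n)) (by positivity) fun v => by
    refine le_trans ?_ (hform v)
    have : 0 ≤ M * (N * (α ⬝ᵥ v) ^ 2) := by positivity
    have h2 : 2 * M * (1 / (8 * n) * (v ⬝ᵥ v)) = M / (4 * n) * (v ⬝ᵥ v) := by
      field_simp; ring
    linarith
  have htr : M * N / (2 * n) ≤ (Tᵀ * H * T).trace := by
    calc M * N / (2 * n) = 2 * M * N * (1 / (4 * n)) := by field_simp; ring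
      _ ≤ 2 * M * N * ∑ i, α i ^ 2 := by gcongr
      _ = ∑ i, 2 * M * (N * α i ^ 2) := by
          rw [Finset.mul_sum]; exact Finset.sum_congr rfl fun i _ => by ring
      _ ≤ _ := Finset.sum_le_sum fun i _ => by
          have h1 := hform (Pi.single i 1)
          rw [single_one_dotProduct, dotProduct_single_one, Matrix.mulVec_single_one,
            single_one_dotProduct, Pi.single_eq_same] at h1
          refine le_trans ?_ h1
          have : 0 ≤ M * (1 / (8 * n)) := by positivity
          linarith
  calc (M / (4 * n)) ^ (n - 1) * (M * N / (2 * n))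
      ≤ (M / (4 * n)) ^ (n - 1) * (Tᵀ * H * T).trace := by gcongr
    _ ≤ n * (Tᵀ * H * T).det := hdet
    _ = n * (H.det * T.det ^ 2) := by
        rw [Matrix.det_mul, Matrix.det_mul, Matrix.det_transpose]; ring
    _ ≤ _ := by
        have := h.det_le x hxC
        gcongr

end PinchedSublevel

/-- Quantitative Aleksandrov maximum principle: points of a sublevel set at which a nonnegative
affine function is relatively small are not deep. -/
theorem exists_depth_constant {n : ℕ} (hn : 0 < n) {lam Lam : ℝ} (hlam : 0 < lam)
    (hLam : 0 ≤ Lam) :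
    ∃ ρ : ℝ, 0 < ρ ∧ ρ ≤ 1 / 2 ∧
      ∀ (u : E n → ℝ) (p : E n →L[ℝ] ℝ) (c : ℝ) (C : Set (E n)),
        PinchedSublevel u lam Lam p c C → ∀ M : ℝ, (∀ x ∈ C, p x + c - u x ≤ M) →
        ∀ (q : E n →L[ℝ] ℝ) (e : ℝ), (∀ x ∈ C, 0 ≤ q x + e) →
        ∀ z ∈ C, u z < p z + c → ∀ w ∈ C, 0 < q w + e → q z + e ≤ ρ * (q w + e) →
        p z + c - u z ≤ M / 2 := by
  have hn' : (0 : ℝ) < n := by exact_mod_cast hn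
  set K : ℝ := n * (Lam / lam * (9 * n ^ 2) ^ n) with hK
  have hK0 : 0 ≤ K := by positivity
  set N : ℝ := 2 * n * (4 * n) ^ (n - 1) * (K + 1) with hN
  have hN0 : 0 < N := by positivity
  refine ⟨min (1 / 2) (1 / (16 * N)), by positivity, min_le_left _ _, ?_⟩
  intro u p c C h M hdepth q e hq z hz hzlt w hw hqw hqz
  by_contra! hdeep
  have hM : 0 < M := by have := hdepth z hz; linarith
  obtain ⟨T, hT0, hTC, hT⟩ := exists_frame h.isCompact (h.mem_nhds z hz hzlt)
  have hupper := h.mul_det_sq_le hn hM hdepth hz hTC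
  have hlower := h.le_mul_det_sq hn hM hq hz hw hqw (min_le_left _ _) hN0.le (by
    calc N * min (1 / 2) (1 / (16 * N)) ≤ N * (1 / (16 * N)) := by
          gcongr; exact min_le_right _ _
      _ = 1 / 16 := by field_simp) hqz hdeep hT0 hT
  have h1 : (M / (4 * n)) ^ (n - 1) * (M * N / (2 * n)) = M ^ n * (K + 1) := by
    obtain ⟨k, rfl⟩ : ∃ k, n = k + 1 := ⟨n - 1, by omega⟩
    simp only [hN, Nat.add_sub_cancel]
    rw [div_pow, pow_succ M k]
    field_simp
  have h2 : n * (Lam * T.det ^ 2) ≤ M ^ n * K := by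
    have h3 : T.det ^ 2 ≤ (9 * n ^ 2 * M) ^ n / lam := by
      rw [le_div_iff₀ hlam]; linarith
    calc n * (Lam * T.det ^ 2) ≤ n * (Lam * ((9 * n ^ 2 * M) ^ n / lam)) := by gcongr
      _ = M ^ n * K := by rw [hK, mul_pow]; ring
  have h3 : 0 < M ^ n := by positivity
  rw [h1] at hlower
  linarith

/-! ### Sections -/

section Sections

variable {n : ℕ} {Ω : Set (E n)} {u : E n → ℝ} {lam Lam : ℝ}

theorem MASetup.closure_mem_nhds (hΩ : MASetup Ω u) {x : E n} (hx : x ∈ Ω) :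
    closure Ω ∈ 𝓝 x :=
  mem_of_superset (hΩ.1.mem_nhds hx) subset_closure

theorem MASetup.convexOn (hΩ : MASetup Ω u) : ConvexOn ℝ (closure Ω) u := hΩ.2.2.2.2.2.1

theorem MASetup.contDiffAt (hΩ : MASetup Ω u) {x : E n} (hx : x ∈ Ω) : ContDiffAt ℝ 2 u x :=
  ((hΩ.2.2.2.2.1).contDiffAt (hΩ.closure_mem_nhds hx)).of_le (WithTop.coe_le_coe.2 le_top)

theorem MASetup.pinchedSublevel (hΩ : MASetup Ω u) (hdet : DetBounds Ω u lam Lam)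
    {p : E n →L[ℝ] ℝ} {c : ℝ} (hG : CptIn {x ∈ closure Ω | u x < p x + c} Ω) :
    PinchedSublevel u lam Lam p c (closure {x ∈ closure Ω | u x < p x + c}) where
  isCompact := hG.1
  convex := by
    have h : ConvexOn ℝ (closure Ω) fun x => u x - p x :=
      hΩ.convexOn.sub ((p : E n →ₗ[ℝ] ℝ).concaveOn hΩ.convexOn.1)
    have := h.convex_lt c
    simp only [sub_lt_iff_lt_add'] at this
    exact this.closure
  contDiffAt x hx := hΩ.contDiffAt (hG.2 hx)
  posSemidef x hx :=
    hΩ.convexOn.posSemidef_hess (hΩ.closure_mem_nhds (hG.2 hx)) (hΩ.contDiffAt (hG.2 hx))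
  le_det x hx := (hdet x (hG.2 hx)).1
  det_le x hx := (hdet x (hG.2 hx)).2
  le_affine x hx :=
    ContinuousWithinAt.closure_le hx
      (hΩ.contDiffAt (hG.2 hx)).continuousAt.continuousWithinAt
      (by fun_prop) fun y hy => hy.2.le
  mem_nhds x hx hlt := by
    have hc : ContinuousAt (fun y => p y + c) x := by fun_prop
    filter_upwards [hΩ.closure_mem_nhds (hG.2 hx),
      (hΩ.contDiffAt (hG.2 hx)).continuousAt.eventually_lt hc hlt] with y hy hy'
    exact subset_closure ⟨hy, hy'⟩

/-- In each sublevel set of `u - p - c` compactly contained in `Ω`, the points at which some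
nonnegative affine function is smaller than `ρ` times one of its values have at most half of the
maximal depth. -/
def HasDepthBound (Ω : Set (E n)) (u : E n → ℝ) (ρ : ℝ) : Prop :=
  ∀ (p : E n →L[ℝ] ℝ) (c : ℝ), CptIn {x ∈ closure Ω | u x < p x + c} Ω →
    ∀ M : ℝ, (∀ x ∈ closure Ω, u x < p x + c → p x + c - u x ≤ M) →
    ∀ (q : E n →L[ℝ] ℝ) (e : ℝ), (∀ x ∈ closure Ω, u x < p x + c → 0 ≤ q x + e) →
    ∀ z ∈ closure Ω, u z < p z + c → ∀ w ∈ closure Ω, u w < p w + c →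
    0 < q w + e → q z + e ≤ ρ * (q w + e) → p z + c - u z ≤ M / 2

theorem exists_hasDepthBound (hn : 0 < n) (hlam : 0 < lam) (hLam : 0 ≤ Lam) :
    ∃ ρ : ℝ, 0 < ρ ∧ ρ ≤ 1 / 2 ∧ ∀ (Ω : Set (E n)) (u : E n → ℝ),
      MASetup Ω u → DetBounds Ω u lam Lam → HasDepthBound Ω u ρ := by
  obtain ⟨ρ, hρ0, hρ1, h⟩ := exists_depth_constant hn hlam hLam
  refine ⟨ρ, hρ0, hρ1, fun Ω u hΩ hdet p c hG M hM q e hq z hz hzlt w hw hwlt => ?_⟩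
  refine h u p c _ (hΩ.pinchedSublevel hdet hG) M (fun x hx => ?_) q e (fun x hx => ?_) z
    (subset_closure ⟨hz, hzlt⟩) hzlt w (subset_closure ⟨hw, hwlt⟩)
  · have hc := (hΩ.contDiffAt (hG.2 hx)).continuousAt
    exact ContinuousWithinAt.closure_le hx
      (ContinuousAt.continuousWithinAt (by fun_prop)) continuousWithinAt_const
      fun y hy => hM y hy.1 hy.2
  · exact ContinuousWithinAt.closure_le hx continuousWithinAt_const (by fun_prop)
      fun y hy => hq y hy.1 hy.2

/-- The excess of `u` at `y` over its tangent plane at `x`. -/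
def excess (u : E n → ℝ) (x y : E n) : ℝ := u y - u x - fderiv ℝ u x (y - x)

theorem mem_MASection {x y : E n} {t : ℝ} :
    y ∈ MASection Ω u x t ↔ y ∈ closure Ω ∧ excess u x y < t := by
  simp only [MASection, excess, mem_ofPred_eq]
  refine and_congr_right fun _ => ?_
  constructor <;> intro h <;> linarith

theorem MASection_eq (x : E n) (t : ℝ) :
    MASection Ω u x t = {y ∈ closure Ω | u y < fderiv ℝ u x y +
      (u x - fderiv ℝ u x x + t)} := by
  ext y
  simp only [MASection, mem_ofPred_eq, map_sub]
  refine and_congr_right fun _ => ?_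
  constructor <;> intro h <;> linarith

theorem MASection_mono {x : E n} {s t : ℝ} (hst : s ≤ t) :
    MASection Ω u x s ⊆ MASection Ω u x t := fun y hy => by
  rw [mem_MASection] at hy ⊢
  exact ⟨hy.1, hy.2.trans_le hst⟩

theorem CptIn.mono {A A' B : Set (E n)} (h : CptIn A B) (hA : A' ⊆ A) : CptIn A' B :=
  ⟨h.1.of_isClosed_subset isClosed_closure (closure_mono hA), (closure_mono hA).trans h.2⟩

theorem CptIn.subset {A B : Set (E n)} (h : CptIn A B) : A ⊆ B := subset_closure.trans h.2

theorem excess_self (x : E n) : excess u x x = 0 := by simp [excess]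

theorem MASetup.excess_nonneg (hΩ : MASetup Ω u) {x y : E n} (hx : x ∈ Ω)
    (hy : y ∈ closure Ω) : 0 ≤ excess u x y := by
  have := hΩ.convexOn.add_fderiv_le (subset_closure hx) hy
    ((hΩ.contDiffAt hx).differentiableAt (by norm_num))
  simp only [excess]
  linarith

theorem excess_eq_add (a z y : E n) :
    excess u a y = excess u a z + (fderiv ℝ u z - fderiv ℝ u a) (y - z) + excess u z y := by
  simp only [excess, FunLike.coe_sub, Pi.sub_apply, map_sub]
  ring

set_option maxHeartbeats 2000000 in
/-- Near the center `a` of a section, the tangent planes stay away from `u` outside of the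
section. -/
theorem HasDepthBound.le_excess {ρ : ℝ} (hρ0 : 0 < ρ) (hρ1 : ρ ≤ 1 / 2)
    (hb : HasDepthBound Ω u ρ) (hΩ : MASetup Ω u) {a z w : E n} {t : ℝ} (ht : 0 < t)
    (ha : a ∈ Ω) (hS : CptIn (MASection Ω u a t) Ω) (hz : z ∈ Ω)
    (hza : excess u a z < ρ / 8 * t) (hw : w ∈ closure Ω) (hwa : t ≤ excess u a w) :
    ρ / 64 * t ≤ excess u z w := by
  by_contra! hlt
  set s : ℝ := ρ / 8 with hs
  have hs0 : 0 < s := by positivity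
  have hs1 : s ≤ 1 / 16 := by linarith
  have hst : 0 < s * t := by positivity
  set q : E n →L[ℝ] ℝ := fderiv ℝ u z - fderiv ℝ u a with hq
  set l : E n → ℝ := fun y => excess u a z + q (y - z) with hl
  have hle : ∀ y ∈ closure Ω, l y ≤ excess u a y := fun y hy => by
    have := hΩ.excess_nonneg hz hy
    rw [excess_eq_add a z y]
    simp only [hl]
    linarith
  have hz0 := hΩ.excess_nonneg ha (subset_closure hz)
  set p : E n →L[ℝ] ℝ := fderiv ℝ u a + (1 - s) • q with hp
  set c : ℝ := u a - fderiv ℝ u a a + (1 - s) * (excess u a z - q z) + s * t / 2 with hc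
  have hdepth : ∀ y, p y + c - u y = (1 - s) * l y + s * t / 2 - excess u a y := by
    intro y
    simp only [hp, hc, hl, excess, map_sub, FunLike.coe_add, Pi.add_apply,
      FunLike.coe_smul, Pi.smul_apply, smul_eq_mul]
    ring
  have hG : {x ∈ closure Ω | u x < p x + c} ⊆ MASection Ω u a t := by
    rintro y ⟨hy, hylt⟩
    refine mem_MASection.2 ⟨hy, ?_⟩
    have h1 := hdepth y
    have h2 := hle y hy
    have h3 := hΩ.excess_nonneg ha hy
    nlinarith
  have hlow : ∀ y ∈ closure Ω, u y < p y + c → -(s * t) ≤ l y := by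
    intro y hy hylt
    have h1 := hdepth y
    have h3 := hΩ.excess_nonneg ha hy
    nlinarith
  have hqe : ∀ y, q y + (excess u a z - q z + s * t) = l y + s * t := by
    intro y
    simp only [hl, map_sub]
    ring
  have hlz : l z = excess u a z := by simp [hl]
  have hlw : (1 - s) * t < l w := by
    have h1 := excess_eq_add (u := u) a z w
    simp only [hl]
    nlinarith
  -- a point of the segment from `z` to `w` at which `l` takes the value `t / 4`
  have hquarter : l z < t / 4 := by rw [hlz]; nlinarith
  have hgap : 0 < l w - l z := by nlinarith
  set τ : ℝ := (t / 4 - l z) / (l w - l z) with hτ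
  have hτ0 : 0 ≤ τ := div_nonneg (by linarith) hgap.le
  have hτ1 : τ ≤ 1 := (div_le_one hgap).2 (by nlinarith)
  set y : E n := AffineMap.lineMap z w τ with hy
  have hyΩ : y ∈ closure Ω := hΩ.convexOn.1.lineMap_mem (subset_closure hz) hw ⟨hτ0, hτ1⟩
  have hyz : y - z = τ • (w - z) := by
    rw [hy, AffineMap.lineMap_apply_module']; simp
  have hly : l y = t / 4 := by
    have h1 : l y = l z + τ * (l w - l z) := by
      simp only [hl, hyz, map_smul, smul_eq_mul, sub_self, map_zero]
      ring
    rw [h1, hτ, div_mul_cancel₀ _ hgap.ne']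
    ring
  have hzy : excess u z y ≤ ρ / 64 * t := by
    have h1 : u y ≤ (1 - τ) * u z + τ * u w := by
      have h2 := hΩ.convexOn.2 (subset_closure hz) hw (sub_nonneg.2 hτ1) hτ0 (by ring)
      rw [hy, AffineMap.lineMap_apply_module]
      simpa using h2
    have h2 : excess u z y ≤ τ * excess u z w := by
      simp only [excess, hyz, map_smul, smul_eq_mul]
      nlinarith
    have h3 := hΩ.excess_nonneg hz hw
    nlinarith
  have hay : excess u a y ≤ t / 4 + ρ / 64 * t := by
    rw [excess_eq_add a z y]
    simp only [hl] at hly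
    linarith
  have hfinal := hb p c (hS.mono hG) (s * t * (1 / 2 + s)) (fun x hx hxlt => by
      rw [hdepth]
      have h1 := hle x hx
      have h2 := hlow x hx hxlt
      nlinarith) q (excess u a z - q z + s * t) (fun x hx hxlt => by
      rw [hqe]; linarith [hlow x hx hxlt]) z (subset_closure hz) (by
      have := hdepth z
      rw [hlz] at this
      nlinarith) y hyΩ (by
      have := hdepth y
      rw [hly] at this
      nlinarith) (by rw [hqe, hly]; positivity) (by
      rw [hqe, hqe, hly, hlz]
      nlinarith)
  rw [hdepth, hlz] at hfinal
  nlinarith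

theorem HasDepthBound.mul_le_of_mem_half {ρ : ℝ} (hb : HasDepthBound Ω u ρ)
    (hΩ : MASetup Ω u) {b z w : E n} {t : ℝ} (hbΩ : b ∈ Ω)
    (hS : CptIn (MASection Ω u b t) Ω) {q : E n →L[ℝ] ℝ} {e : ℝ}
    (hq : ∀ x ∈ MASection Ω u b t, 0 ≤ q x + e) (hz : z ∈ MASection Ω u b (t / 2))
    (hw : w ∈ MASection Ω u b t) : ρ * (q w + e) ≤ q z + e := by
  have ht : 0 < t := by
    rw [mem_MASection] at hz
    linarith [hΩ.excess_nonneg hbΩ hz.1]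
  have hzt := MASection_mono (show t / 2 ≤ t by linarith) hz
  rcases (hq w hw).eq_or_lt with h0 | hpos
  · rw [← h0, mul_zero]; exact hq z hzt
  by_contra! hlt
  have hset := MASection_eq (Ω := Ω) (u := u) b t
  have hmem : ∀ x ∈ closure Ω, u x < fderiv ℝ u b x + (u b - fderiv ℝ u b b + t) →
      x ∈ MASection Ω u b t := fun x hx hxlt => by rw [hset]; exact ⟨hx, hxlt⟩
  have hdepth : ∀ x, fderiv ℝ u b x + (u b - fderiv ℝ u b b + t) - u x = t - excess u b x := by
    intro x
    simp only [excess, map_sub]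
    ring
  rw [hset] at hS hzt hw
  have := hb _ _ hS t (fun x hx _ => by
    rw [hdepth]; linarith [hΩ.excess_nonneg hbΩ hx]) q e (fun x hx hxlt => hq x (hmem x hx hxlt))
    z hzt.1 hzt.2 w hw.1 hw.2 hpos hlt.le
  rw [hdepth] at this
  linarith [(mem_MASection.1 hz).2]

/-- Sections shrink geometrically in every direction. -/
theorem HasDepthBound.width_le {ρ : ℝ} (hb : HasDepthBound Ω u ρ) (hΩ : MASetup Ω u)
    {b : E n} {t W : ℝ} (ht : 0 < t) (hbΩ : b ∈ Ω) (hS : CptIn (MASection Ω u b t) Ω)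
    {q : E n →L[ℝ] ℝ} (hW : ∀ x ∈ MASection Ω u b t, ∀ y ∈ MASection Ω u b t, q x - q y ≤ W)
    (k : ℕ) :
    ∀ x ∈ MASection Ω u b (t / 2 ^ k), ∀ y ∈ MASection Ω u b (t / 2 ^ k),
      q x - q y ≤ (1 - ρ) ^ k * W := by
  induction k with
  | zero => simpa using hW
  | succ k ih =>
    intro x hx y hy
    have hk : t / 2 ^ (k + 1) = t / 2 ^ k / 2 := by rw [pow_succ, div_div]
    rw [hk] at hx hy
    have hpos : 0 < t / 2 ^ k := by positivity
    have hsub : MASection Ω u b (t / 2 ^ k) ⊆ MASection Ω u b t :=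
      MASection_mono (div_le_self ht.le (one_le_pow₀ (by norm_num)))
    have hy' := MASection_mono (show t / 2 ^ k / 2 ≤ t / 2 ^ k by linarith) hy
    have := hb.mul_le_of_mem_half hΩ hbΩ (hS.mono hsub) (q := -q)
      (e := q y + (1 - ρ) ^ k * W) (fun v hv => by
        have := ih v hv y hy'
        simp only [FunLike.coe_neg, Pi.neg_apply]
        linarith) hx hy'
    simp only [FunLike.coe_neg, Pi.neg_apply] at this
    rw [pow_succ]
    linarith

/-- Inside a small concentric section the excess between two points is small. -/
theorem HasDepthBound.excess_le {ρ : ℝ} (hρ0 : 0 < ρ)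
    (hb : HasDepthBound Ω u ρ) (hΩ : MASetup Ω u) {b z w : E n} {t : ℝ} (ht : 0 < t)
    (hbΩ : b ∈ Ω) (hS : CptIn (MASection Ω u b t) Ω) {k : ℕ} (hk : 1 ≤ k)
    (hz : z ∈ MASection Ω u b (t / 2 ^ k)) (hw : w ∈ MASection Ω u b (t / 2 ^ k)) :
    excess u z w ≤ (1 / 2 ^ k + (1 - ρ) ^ k / ρ) * t := by
  have hz2 : z ∈ MASection Ω u b (t / 2) := by
    refine MASection_mono ?_ hz
    gcongr
    exact le_self_pow₀ (by norm_num) (by omega)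
  have hzt : z ∈ MASection Ω u b t := MASection_mono (by linarith) hz2
  have hzΩ : z ∈ Ω := hS.subset hzt
  set q : E n →L[ℝ] ℝ := fderiv ℝ u z - fderiv ℝ u b with hq
  have hzb := hΩ.excess_nonneg hbΩ hzt.1
  have hup : ∀ y ∈ MASection Ω u b t, q y - q z ≤ t := by
    intro y hy
    have h1 := excess_eq_add (u := u) b z y
    have h2 := hΩ.excess_nonneg hzΩ hy.1
    have h3 := (mem_MASection.1 hy).2
    rw [← hq, map_sub] at h1
    linarith
  have hlow : ∀ y ∈ MASection Ω u b t, ρ * (t - (q y - q z)) ≤ t := by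
    intro y hy
    have := hb.mul_le_of_mem_half hΩ hbΩ hS (q := -q) (e := t + q z) (fun v hv => by
      have := hup v hv
      simp only [FunLike.coe_neg, Pi.neg_apply]
      linarith) hz2 hy
    simp only [FunLike.coe_neg, Pi.neg_apply] at this
    linarith
  have hwidth := hb.width_le hΩ ht hbΩ hS (q := q) (W := t / ρ) (fun x hx y hy => by
    rw [le_div_iff₀ hρ0]
    have h1 := hup x hx
    have h2 := hlow y hy
    nlinarith) k z hz w hw
  have h1 := excess_eq_add (u := u) b z w
  rw [← hq, map_sub] at h1
  have h2 := (mem_MASection.1 hw).2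
  have h3 : (1 / 2 ^ k + (1 - ρ) ^ k / ρ) * t = t / 2 ^ k + (1 - ρ) ^ k * (t / ρ) := by ring
  rw [h3]
  linarith

theorem MASetup.section_mem_nhds (hΩ : MASetup Ω u) {x : E n} (hx : x ∈ Ω) {t : ℝ}
    (ht : 0 < t) : MASection Ω u x t ∈ 𝓝 x := by
  have hc := (hΩ.contDiffAt hx).continuousAt
  have hexc : ContinuousAt (excess u x) x := by
    unfold excess
    fun_prop
  filter_upwards [hΩ.closure_mem_nhds hx,
    hexc.eventually_lt_const (by rwa [excess_self])] with y hy hy'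
  exact mem_MASection.2 ⟨hy, hy'⟩

/-- Engulfing property of sections, with constants depending only on the dimension and on the
bounds for the Hessian determinant. -/
theorem exists_engulfing_constant (hn : 0 < n) (hlam : 0 < lam) (hLam : 0 ≤ Lam) :
    ∃ δ : ℝ, 0 < δ ∧ δ < 1 ∧ ∀ (Ω : Set (E n)) (u : E n → ℝ),
      MASetup Ω u → DetBounds Ω u lam Lam → ∀ a ∈ Ω, ∀ b ∈ Ω, ∀ s t : ℝ, 0 < s → 0 < t →
      CptIn (MASection Ω u a s) Ω → CptIn (MASection Ω u b t) Ω → t ≤ 2 * s →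
      (MASection Ω u b (δ * t) ∩ MASection Ω u a (δ * s)).Nonempty →
      MASection Ω u b (δ * t) ⊆ MASection Ω u a s := by
  obtain ⟨ρ, hρ0, hρ1, hbound⟩ := exists_hasDepthBound hn hlam hLam
  obtain ⟨k, hk1, hk⟩ : ∃ k : ℕ, 1 ≤ k ∧ 1 / 2 ^ k + (1 - ρ) ^ k / ρ < ρ / 128 := by
    have h1 : Tendsto (fun k : ℕ => (1 / 2 : ℝ) ^ k + (1 - ρ) ^ k / ρ) atTop (𝓝 (0 + 0 / ρ)) :=
      (tendsto_pow_atTop_nhds_zero_of_lt_one (by norm_num) (by norm_num)).add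
        ((tendsto_pow_atTop_nhds_zero_of_lt_one (by linarith) (by linarith)).div_const ρ)
    obtain ⟨k, hk1, hk2⟩ := ((eventually_ge_atTop 1).and
      (h1.eventually_lt_const (show 0 + 0 / ρ < ρ / 128 by simp [hρ0]))).exists
    exact ⟨k, hk1, by simpa using hk2⟩
  refine ⟨min (ρ / 8) (1 / 2 ^ k), by positivity, (min_le_left _ _).trans_lt (by linarith), ?_⟩
  set δ := min (ρ / 8) (1 / 2 ^ k)
  rintro Ω u hΩ hdet a ha b hb s t hs ht hSa hSb hts ⟨z, hzb, hza⟩ w hw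
  have hsub : MASection Ω u b (δ * t) ⊆ MASection Ω u b (t / 2 ^ k) := by
    refine MASection_mono ?_
    calc δ * t ≤ 1 / 2 ^ k * t := by gcongr; exact min_le_right _ _
      _ = t / 2 ^ k := by ring
  have hsub' : MASection Ω u b (t / 2 ^ k) ⊆ MASection Ω u b t :=
    MASection_mono (div_le_self ht.le (one_le_pow₀ (by norm_num)))
  have hsmall := (hbound Ω u hΩ hdet).excess_le hρ0 hΩ ht hb hSb hk1 (hsub hzb) (hsub hw)
  by_contra hout
  have hge : s ≤ excess u a w := by
    by_contra! hlt
    exact hout (mem_MASection.2 ⟨hw.1, hlt⟩)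
  have hza' : excess u a z < ρ / 8 * s :=
    (mem_MASection.1 hza).2.trans_le (by gcongr; exact min_le_left _ _)
  have hlarge := (hbound Ω u hΩ hdet).le_excess hρ0 hρ1 hΩ hs ha hSa
    (hSb.subset (hsub' (hsub hzb))) hza' hw.1 hge
  nlinarith

end Sections

/-- Lemma 2.3: Vitali covering lemma by sections. -/
theorem vitali_covering_sections (n : ℕ) (hn : 2 ≤ n)
    (lam Lam : ℝ) (hlam : 0 < lam) (hlL : lam ≤ Lam) :
    ∃ δ : ℝ, 0 < δ ∧ δ < 1 ∧
      ∀ (Ω : Set (E n)) (u : E n → ℝ),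
      MASetup Ω u → DetBounds Ω u lam Lam →
      ∀ D : Set (E n), IsCompact D → D ⊆ Ω →
      ∀ h : E n → ℝ, (∀ x ∈ D, 0 < h x ∧ CptIn (MASection Ω u x (h x)) Ω) →
      ∃ s : Finset (E n), (↑s : Set (E n)) ⊆ D ∧
        D ⊆ ⋃ x ∈ s, MASection Ω u x (h x) ∧
        ((s : Set (E n)).Pairwise fun a b =>
          Disjoint (MASection Ω u a (δ * h a)) (MASection Ω u b (δ * h b))) := by
  obtain ⟨δ, hδ0, hδ1, hengulf⟩ :=
    exists_engulfing_constant (n := n) (by omega) hlam (hlam.le.trans hlL)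
  refine ⟨δ, hδ0, hδ1, fun Ω u hΩ hdet D hD hDΩ h hh => ?_⟩
  obtain ⟨t, htD, hcover⟩ := hD.elim_nhds_subcover (fun x => MASection Ω u x (δ * h x))
    fun x hx => hΩ.section_mem_nhds (hDΩ hx) (mul_pos hδ0 (hh x hx).1)
  obtain ⟨R, hR⟩ := (t.finite_toSet.image h).bddAbove
  obtain ⟨s, hst, hdisj, hs⟩ := Vitali.exists_disjoint_subfamily_covering_enlargement
    (fun x => MASection Ω u x (δ * h x)) (t : Set (E n)) h 2 one_lt_two
    (fun x hx => (hh x (htD x hx)).1.le) R (fun x hx => hR (mem_image_of_mem h hx))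
    fun x hx => ⟨x, mem_of_mem_nhds
      (hΩ.section_mem_nhds (hDΩ (htD x hx)) (mul_pos hδ0 (hh x (htD x hx)).1))⟩
  have hfin : s.Finite := t.finite_toSet.subset hst
  refine ⟨hfin.toFinset, ?_, fun x hx => ?_, ?_⟩
  · rw [hfin.coe_toFinset]
    exact fun x hx => htD x (hst hx)
  · obtain ⟨b, hbt, hxb⟩ := mem_iUnion₂.1 (hcover hx)
    obtain ⟨a, has, hne, hle⟩ := hs b hbt
    have haD := htD a (hst has)
    have hbD := htD b hbt
    exact mem_iUnion₂.2 ⟨a, hfin.mem_toFinset.2 has,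
      hengulf Ω u hΩ hdet a (hDΩ haD) b (hDΩ hbD) (h a) (h b) (hh a haD).1 (hh b hbD).1
        (hh a haD).2 (hh b hbD).2 hle hne hxb⟩
  · rw [hfin.coe_toFinset]
    exact hdisj
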